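/- For every matroid median instance and every fractional solution (x,y), there exists an integral solution whose cost is at most 10 times the cost of (x,y). -/

import Mathlib

open scoped Classical
open Finset

/-- The rank function of a matroid: the maximum cardinality of an independent
subset of the given set. -/
noncomputable def matroidRank {α : Type*} (M : Matroid α) (S : Finset α) : ℕ :=
  (S.powerset.filter (fun I : Finset α => M.Indep ↑I)).sup Finset.card

lemma mm_rank_eq {α : Type*} (M : Matroid α) (S : Finset α) :
    ((matroidRank M S : ℕ) : ℕ∞) = M.eRk (S : Set α) := by
  apply le_antisymm
  · have hne : (S.powerset.filter (fun I : Finset α => M.Indep ↑I)).Nonempty :=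
      ⟨∅, by simp⟩
    obtain ⟨I, hI, hs⟩ := Finset.exists_mem_eq_sup _ hne Finset.card
    rw [matroidRank, hs]
    simp only [mem_filter, mem_powerset] at hI
    rw [← Set.encard_coe_eq_coe_finsetCard]
    exact hI.2.encard_le_eRk_of_subset (by exact_mod_cast hI.1)
  · rw [Matroid.eRk_le_iff]
    intro I hIS hI
    have hfin : I.Finite := S.finite_toSet.subset hIS
    lift I to Finset α using hfin
    rw [Set.encard_coe_eq_coe_finsetCard]
    have : I.card ≤ matroidRank M S :=
      Finset.le_sup (f := Finset.card) (by
        simp only [mem_filter, mem_powerset]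
        exact ⟨by exact_mod_cast hIS, hI⟩)
    exact_mod_cast this

lemma mm_rank_submod {α : Type*} (M : Matroid α) (S T : Finset α) :
    matroidRank M (S ∩ T) + matroidRank M (S ∪ T) ≤ matroidRank M S + matroidRank M T := by
  have h := M.eRk_submod (S : Set α) (T : Set α)
  rw [← Finset.coe_inter, ← Finset.coe_union] at h
  simp only [← mm_rank_eq] at h
  exact_mod_cast h

lemma mm_rank_empty {α : Type*} (M : Matroid α) : matroidRank M (∅ : Finset α) = 0 := by
  simp [matroidRank]

lemma mm_rank_le_card {α : Type*} (M : Matroid α) (S : Finset α) : matroidRank M S ≤ S.card := by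
  apply Finset.sup_le
  intro I hI
  simp only [mem_filter, mem_powerset] at hI
  exact card_le_card hI.1

lemma mm_indep_of_card_le {α : Type*} (M : Matroid α) (S : Finset α)
    (h : S.card ≤ matroidRank M S) : M.Indep (S : Set α) := by
  have hne : (S.powerset.filter (fun I : Finset α => M.Indep ↑I)).Nonempty :=
      ⟨∅, by simp⟩
  obtain ⟨I, hI, hs⟩ := Finset.exists_mem_eq_sup _ hne Finset.card
  rw [matroidRank, hs] at h
  simp only [mem_filter, mem_powerset] at hI
  rw [← Finset.eq_of_subset_of_card_le hI.1 h]
  exact hI.2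

/-- Greedy selection of a maximal conflict-free set in order of weight. -/
lemma mm_greedy {ι : Type*} (w : ι → ℝ) (R : ι → ι → Prop) (hrefl : ∀ i, R i i) (C : Finset ι) :
    ∃ T ⊆ C, (∀ s ∈ T, ∀ t ∈ T, R s t → R t s → s = t) ∧
      ∀ j ∈ C, ∃ t ∈ T, w t ≤ w j ∧ R t j := by
  induction C using Finset.strongInduction with
  | H C ih =>
    rcases C.eq_empty_or_nonempty with rfl | hne
    · exact ⟨∅, by simp⟩
    obtain ⟨m, hm, hmin⟩ := Finset.exists_min_image C w hne
    have hss : C.filter (fun j => ¬ R m j) ⊂ C := by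
      refine (Finset.filter_ssubset).2 ⟨m, hm, by simpa using hrefl m⟩
    obtain ⟨T, hTC, hT1, hT2⟩ := ih _ hss
    refine ⟨insert m T, ?_, ?_, ?_⟩
    · intro t ht
      rcases mem_insert.1 ht with rfl | ht
      · exact hm
      · exact (mem_filter.1 (hTC ht)).1
    · intro s hs t ht hst hts
      rcases mem_insert.1 hs with hs1 | hs1 <;> rcases mem_insert.1 ht with ht1 | ht1
      · rw [hs1, ht1]
      · rw [hs1] at hst
        exact absurd hst (mem_filter.1 (hTC ht1)).2
      · rw [ht1] at hts
        exact absurd hts (mem_filter.1 (hTC hs1)).2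
      · exact hT1 s hs1 t ht1 hst hts
    · intro j hj
      by_cases hR : R m j
      · exact ⟨m, mem_insert_self _ _, hmin j hj, hR⟩
      · obtain ⟨t, ht, h⟩ := hT2 j (mem_filter.2 ⟨hj, hR⟩)
        exact ⟨t, mem_insert_of_mem ht, h⟩

/-- A linear functional attains its minimum on a compact set at an extreme point. -/
lemma mm_exists_extreme_min {E : Type*} [Fintype E] (P : Set (E → ℝ)) (hP : IsCompact P)
    (hne : P.Nonempty) (l : (E → ℝ) →L[ℝ] ℝ) :
    ∃ z ∈ P.extremePoints ℝ, ∀ y ∈ P, l z ≤ l y := by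
  have hexp : IsExposed ℝ P ((-l).toExposed P) := ContinuousLinearMap.toExposed.isExposed
  have hc := hexp.isCompact hP
  obtain ⟨m, hm, hmin⟩ := hP.exists_isMinOn hne l.continuous.continuousOn
  have hne' : ((-l).toExposed P).Nonempty :=
    ⟨m, hm, fun y hy => by simpa using hmin hy⟩
  obtain ⟨z, hz⟩ := hc.extremePoints_nonempty hne'
  refine ⟨z, hexp.isExtreme.extremePoints_subset_extremePoints hz, fun y hy => ?_⟩
  have := hz.1.2 y hy
  simpa using this

/-- `y` takes an integer value. -/
def mmInt (t : ℝ) : Prop := ∃ n : ℤ, t = n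

lemma mmInt.add {s t : ℝ} (hs : mmInt s) (ht : mmInt t) : mmInt (s + t) := by
  obtain ⟨m, rfl⟩ := hs
  obtain ⟨n, rfl⟩ := ht
  exact ⟨m + n, by push_cast; ring⟩

lemma mmInt.sub {s t : ℝ} (hs : mmInt s) (ht : mmInt t) : mmInt (s - t) := by
  obtain ⟨m, rfl⟩ := hs
  obtain ⟨n, rfl⟩ := ht
  exact ⟨m - n, by push_cast; ring⟩

lemma mmInt.sum {ι : Type*} (s : Finset ι) (g : ι → ℝ) (h : ∀ i ∈ s, mmInt (g i)) :
    mmInt (∑ i ∈ s, g i) := by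
  induction s using Finset.induction_on with
  | empty => exact ⟨0, by simp⟩
  | insert a s ha ih =>
    rw [Finset.sum_insert ha]
    exact (h a (mem_insert_self _ _)).add (ih fun i hi => h i (mem_insert_of_mem hi))

lemma mm_half {E A : Type*} [Fintype E] (y : E → ℝ) (a : E → Option A)
    (ha : ∀ k, mmInt (∑ e with a e = some k, y e)) (Fr : Finset E)
    (hFr : ∀ e, e ∈ Fr ↔ ¬ mmInt (y e)) :
    ∃ A' : Finset (Option A), (∀ k, some k ∉ A' → ∀ e ∈ Fr, a e ≠ some k) ∧
      2 * A'.card ≤ Fr.card ∧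
      (2 * A'.card = Fr.card → ∀ w : E → ℝ, (∀ e, e ∉ Fr → w e = 0) →
        ∑ e, w e = ∑ k ∈ A', ∑ e with a e = k, w e) := by
  set A' := (Fr.image a).erase none with hA'
  set Fr' := Fr.filter (fun e => a e ≠ none) with hFr'
  have hmaps : ∀ e ∈ Fr', a e ∈ A' := by
    intro e he
    rw [hFr', mem_filter] at he
    exact mem_erase.2 ⟨he.2, mem_image_of_mem _ he.1⟩
  have hcard : Fr'.card = ∑ k ∈ A', (Fr'.filter (fun e => a e = k)).card :=
    Finset.card_eq_sum_card_fiberwise hmaps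
  have h2 : ∀ k ∈ A', 2 ≤ (Fr'.filter (fun e => a e = k)).card := by
    intro k hk
    rw [hA', mem_erase, mem_image] at hk
    obtain ⟨hk0, e, he, hek⟩ := hk
    by_contra hlt
    have he' : e ∈ Fr'.filter (fun e => a e = k) := by
      rw [mem_filter, hFr', mem_filter]
      exact ⟨⟨he, by rw [hek]; exact hk0⟩, hek⟩
    have h1 : (Fr'.filter (fun e => a e = k)).card = 1 := by
      have := card_pos.2 ⟨e, he'⟩
      omega
    obtain ⟨e0, he0⟩ := card_eq_one.1 h1
    rw [he0, mem_singleton] at he'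
    subst he'
    obtain ⟨k', rfl⟩ := Option.ne_none_iff_exists'.1 hk0
    have hs := ha k'
    rw [← Finset.add_sum_erase _ y (a := e) (by simp [hek])] at hs
    have h3 : mmInt (∑ x ∈ (univ.filter (fun e => a e = some k')).erase e, y x) := by
      apply mmInt.sum
      intro x hx
      by_contra hxi
      rw [mem_erase, mem_filter] at hx
      have : x ∈ Fr'.filter (fun e => a e = some k') := by
        rw [mem_filter, hFr', mem_filter]
        exact ⟨⟨(hFr x).2 hxi, by rw [hx.2.2]; simp⟩, hx.2.2⟩
      rw [he0, mem_singleton] at this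
      exact hx.1 this
    have := hs.sub h3
    rw [add_sub_cancel_right] at this
    exact (hFr e).1 he this
  have hle : 2 * A'.card ≤ Fr'.card := by
    rw [hcard, mul_comm]
    exact Finset.card_nsmul_le_sum _ _ _ h2
  have hle' : Fr'.card ≤ Fr.card := card_le_card (filter_subset _ _)
  refine ⟨A', ?_, hle.trans hle', ?_⟩
  · intro k hk e he hek
    exact hk (mem_erase.2 ⟨by simp, mem_image.2 ⟨e, he, hek⟩⟩)
  · intro heq w hw
    have hFF : Fr' = Fr := Finset.eq_of_subset_of_card_le (filter_subset _ _) (by omega)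
    have : ∀ k, ∑ e with a e = k, w e = ∑ e ∈ Fr with a e = k, w e := by
      intro k
      symm
      apply Finset.sum_subset
      · intro e he
        simp only [mem_filter] at he ⊢
        exact ⟨mem_univ _, he.2⟩
      · intro e he he'
        apply hw
        intro h
        apply he'
        simp only [mem_filter] at he ⊢
        exact ⟨h, he.2⟩
    simp_rw [this]
    rw [Finset.sum_fiberwise_of_maps_to (by rw [← hFF]; exact hmaps)]
    symm
    exact Finset.sum_subset (subset_univ _) (fun e _ he => hw e he)

/-- If the fibres of two partial labelings all have integral `y`-mass but `y` is not integral,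
there is a nonzero direction supported on the fractional coordinates of zero mass on all fibres. -/
lemma mm_perturb {E A B : Type*} [Fintype E] (y : E → ℝ) (a : E → Option A) (b : E → Option B)
    (ha : ∀ k, mmInt (∑ e with a e = some k, y e))
    (hb : ∀ k, mmInt (∑ e with b e = some k, y e))
    (hne : ∃ e, ¬ mmInt (y e)) :
    ∃ w : E → ℝ, w ≠ 0 ∧ (∀ e, mmInt (y e) → w e = 0) ∧
      (∀ k, ∑ e with a e = some k, w e = 0) ∧ (∀ k, ∑ e with b e = some k, w e = 0) := by
  set Fr : Finset E := univ.filter (fun e => ¬ mmInt (y e)) with hFrdef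
  have hFr : ∀ e, e ∈ Fr ↔ ¬ mmInt (y e) := by simp [hFrdef]
  obtain ⟨A', hA1, hA2, hA3⟩ := mm_half y a ha Fr hFr
  obtain ⟨B', hB1, hB2, hB3⟩ := mm_half y b hb Fr hFr
  have hpos : 0 < Fr.card := by
    obtain ⟨e, he⟩ := hne
    exact card_pos.2 ⟨e, (hFr e).2 he⟩
  let Φ : (E → ℝ) →ₗ[ℝ] ((↥(Frᶜ) → ℝ) × (↥A' → ℝ) × (↥B' → ℝ)) :=
    LinearMap.prod (LinearMap.pi fun e => LinearMap.proj e.1)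
      (LinearMap.prod
        (LinearMap.pi fun k => ∑ e with a e = k.1, LinearMap.proj e)
        (LinearMap.pi fun k => ∑ e with b e = k.1, LinearMap.proj e))
  have hΦ1 : ∀ w e, (Φ w).1 e = w e.1 := fun w e => rfl
  have hΦ2 : ∀ w k, (Φ w).2.1 k = ∑ e with a e = k.1, w e := fun w k => by
    simp [Φ]
  have hΦ3 : ∀ w k, (Φ w).2.2 k = ∑ e with b e = k.1, w e := fun w k => by
    simp [Φ]
  have hninj : ¬ Function.Injective Φ := by
    intro hinj
    have hd1 : Module.finrank ℝ (E → ℝ) = Fintype.card E := Module.finrank_fintype_fun_eq_card ℝ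
    have hd2 : Module.finrank ℝ ((↥(Frᶜ) → ℝ) × (↥A' → ℝ) × (↥B' → ℝ)) =
        Frᶜ.card + (A'.card + B'.card) := by
      simp only [Module.finrank_prod, Module.finrank_fintype_fun_eq_card, Fintype.card_coe]
    have hle := LinearMap.finrank_le_finrank_of_injective hinj
    have hcc := Finset.card_add_card_compl Fr
    rw [hd1, hd2] at hle
    have hsurj : Function.Surjective Φ :=
      (LinearMap.injective_iff_surjective_of_finrank_eq_finrank
        (by rw [hd1, hd2]; omega)).1 hinj
    obtain ⟨w, hw⟩ := hsurj (0, (fun _ => 1), 0)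
    have hw0 : ∀ e, e ∉ Fr → w e = 0 := by
      intro e he
      have := hΦ1 w ⟨e, mem_compl.2 he⟩
      rw [hw] at this
      exact this.symm
    have hsa := hA3 (by omega) w hw0
    have hsb := hB3 (by omega) w hw0
    have e1 : ∑ k ∈ A', ∑ e with a e = k, w e = ∑ k ∈ A', (1 : ℝ) := by
      apply Finset.sum_congr rfl
      intro k hk
      have := hΦ2 w ⟨k, hk⟩
      rw [hw] at this
      exact this.symm
    have e2 : ∑ k ∈ B', ∑ e with b e = k, w e = ∑ k ∈ B', (0 : ℝ) := by
      apply Finset.sum_congr rfl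
      intro k hk
      have := hΦ3 w ⟨k, hk⟩
      rw [hw] at this
      exact this.symm
    rw [e1] at hsa
    rw [e2, hsa] at hsb
    simp at hsb
    rw [hsb] at hA2 hle
    simp at hA2 hle
    omega
  rw [← LinearMap.ker_eq_bot, Submodule.eq_bot_iff] at hninj
  push Not at hninj
  obtain ⟨w, hwk, hw0⟩ := hninj
  rw [LinearMap.mem_ker] at hwk
  have hs : ∀ e, e ∉ Fr → w e = 0 := by
    intro e he
    have := hΦ1 w ⟨e, mem_compl.2 he⟩
    rw [hwk] at this
    exact this.symm
  refine ⟨w, hw0, fun e he => hs e (fun h => (hFr e).1 h he), ?_, ?_⟩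
  · intro k
    by_cases hk : some k ∈ A'
    · have := hΦ2 w ⟨_, hk⟩
      rw [hwk] at this
      exact this.symm
    · apply Finset.sum_eq_zero
      intro e he
      exact hs e (fun h => hA1 k hk e h (mem_filter.1 he).2)
  · intro k
    by_cases hk : some k ∈ B'
    · have := hΦ3 w ⟨_, hk⟩
      rw [hwk] at this
      exact this.symm
    · apply Finset.sum_eq_zero
      intro e he
      exact hs e (fun h => hB1 k hk e h (mem_filter.1 he).2)

lemma mm_left {E : Type*} [Fintype E] (r : Finset E → ℕ) (hr0 : r ∅ = 0)
    (hsub : ∀ S T, r (S ∩ T) + r (S ∪ T) ≤ r S + r T) (z : E → ℝ)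
    (hz : ∀ S : Finset E, ∑ e ∈ S, z e ≤ (r S : ℝ)) :
    ∃ a : E → Option (Finset (Finset E)), (∀ k, mmInt (∑ e with a e = some k, z e)) ∧
      ∀ w : E → ℝ, (∀ k, ∑ e with a e = some k, w e = 0) →
        ∀ S : Finset E, ∑ e ∈ S, z e = (r S : ℝ) → ∑ e ∈ S, w e = 0 := by
  have hlat : ∀ S T : Finset E, ∑ e ∈ S, z e = (r S : ℝ) → ∑ e ∈ T, z e = (r T : ℝ) →
      ∑ e ∈ S ∩ T, z e = (r (S ∩ T) : ℝ) ∧ ∑ e ∈ S ∪ T, z e = (r (S ∪ T) : ℝ) := by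
    intro S T hS hT
    have h1 := Finset.sum_union_inter (s₁ := S) (s₂ := T) (f := z)
    have h2 : ((r (S ∩ T) : ℝ)) + r (S ∪ T) ≤ r S + r T := by exact_mod_cast hsub S T
    have h3 := hz (S ∩ T)
    have h4 := hz (S ∪ T)
    constructor <;> linarith
  set Ti : Finset (Finset E) := univ.filter (fun S => ∑ e ∈ S, z e = (r S : ℝ)) with hTi
  have hmT : ∀ S, S ∈ Ti ↔ ∑ e ∈ S, z e = (r S : ℝ) := by simp [hTi]
  let tau : E → Finset (Finset E) := fun e => Ti.filter (fun S => e ∈ S)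
  have htau : ∀ e S, S ∈ tau e ↔ S ∈ Ti ∧ e ∈ S := by simp [tau]
  let a : E → Option (Finset (Finset E)) := fun e => if tau e = ∅ then none else some (tau e)
  have ha : ∀ e k, a e = some k ↔ tau e ≠ ∅ ∧ tau e = k := by
    intro e k
    by_cases h : tau e = ∅ <;> simp [a, h]
  refine ⟨a, ?_, ?_⟩
  · intro k
    by_cases hex : ∃ e, a e = some k
    swap
    · rw [Finset.filter_false_of_mem]
      · exact ⟨0, by simp⟩
      · intro e _ he
        exact hex ⟨e, he⟩
    obtain ⟨e, he⟩ := hex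
    obtain ⟨hne, rfl⟩ := (ha e k).1 he
    obtain ⟨D, hD, hDmin⟩ := Finset.exists_min_image (tau e) Finset.card
      (Finset.nonempty_iff_ne_empty.2 hne)
    obtain ⟨hDT, heD⟩ := (htau e D).1 hD
    have hDsub : ∀ S ∈ tau e, D ⊆ S := by
      intro S hS
      obtain ⟨hST, heS⟩ := (htau e S).1 hS
      have h1 : D ∩ S ∈ tau e :=
        (htau e _).2 ⟨(hmT _).2 (hlat D S ((hmT _).1 hDT) ((hmT _).1 hST)).1,
          mem_inter.2 ⟨heD, heS⟩⟩
      have h2 := Finset.eq_of_subset_of_card_le (inter_subset_left) (hDmin _ h1)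
      exact Finset.inter_eq_left.1 h2
    set V : Finset E := (Ti.filter (fun S => e ∉ S)).sup (fun S => S ∩ D) with hV
    have hVT : V ∈ Ti := by
      rw [hV]
      apply Finset.sup_induction (p := fun S => S ∈ Ti)
      · rw [hmT]; simp [hr0]
      · intro S hS T hT
        exact (hmT _).2 (hlat S T ((hmT _).1 hS) ((hmT _).1 hT)).2
      · intro S hS
        exact (hmT _).2 (hlat S D ((hmT _).1 (mem_filter.1 hS).1) ((hmT _).1 hDT)).1
    have hVmem : ∀ x, x ∈ V ↔ ∃ S, (S ∈ Ti ∧ e ∉ S) ∧ x ∈ S ∧ x ∈ D := by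
      intro x
      rw [hV, Finset.mem_sup]
      simp only [mem_filter, mem_inter]
    have hVD : V ⊆ D := by
      intro x hx
      obtain ⟨S, -, -, h⟩ := (hVmem x).1 hx
      exact h
    have hfib : (univ.filter (fun x => a x = some (tau e))) = D \ V := by
      ext x
      simp only [mem_filter, mem_univ, true_and, mem_sdiff, ha]
      constructor
      · rintro ⟨-, hx⟩
        have hxD : x ∈ D := ((htau x D).1 (hx ▸ hD)).2
        refine ⟨hxD, fun hxV => ?_⟩
        obtain ⟨S, ⟨hS, heS⟩, hxS, -⟩ := (hVmem x).1 hxV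
        have : S ∈ tau x := (htau x S).2 ⟨hS, hxS⟩
        rw [hx] at this
        exact heS ((htau e S).1 this).2
      · rintro ⟨hxD, hxV⟩
        have : tau x = tau e := by
          ext S
          rw [htau]
          constructor
          · rintro ⟨hS, hxS⟩
            by_contra hn
            refine hxV ((hVmem x).2 ⟨S, ⟨hS, fun h => hn ((htau e S).2 ⟨hS, h⟩)⟩, hxS, hxD⟩)
          · intro hS
            exact ⟨((htau e S).1 hS).1, hDsub S hS hxD⟩
        exact ⟨by rw [this]; exact hne, this⟩
    rw [hfib]
    have := Finset.sum_sdiff (f := z) hVD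
    rw [(hmT _).1 hVT, (hmT _).1 hDT] at this
    refine ⟨(r D : ℤ) - r V, ?_⟩
    push_cast
    linarith
  · intro w hw S hS
    have hST := (hmT S).2 hS
    rw [← Finset.sum_fiberwise_of_maps_to (s := S) (t := S.image tau) (g := tau)
      (fun e he => mem_image_of_mem _ he)]
    apply Finset.sum_eq_zero
    intro k hk
    obtain ⟨e, he, rfl⟩ := mem_image.1 hk
    rw [← hw (tau e)]
    apply Finset.sum_congr _ (fun _ _ => rfl)
    ext x
    simp only [mem_filter, mem_univ, true_and, ha]
    have hSe : S ∈ tau e := (htau e S).2 ⟨hST, he⟩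
    constructor
    · rintro ⟨_, h⟩
      rw [h]
      exact ⟨Finset.nonempty_iff_ne_empty.1 ⟨S, hSe⟩, rfl⟩
    · rintro ⟨_, h⟩
      rw [← h] at hSe
      exact ⟨((htau x S).1 hSe).2, h⟩

lemma mm_right {E β γ : Type*} [Fintype E] (b : E → β) (g : β → γ) (Kb : Finset β)
    (Kg : Finset γ) (z : E → ℝ) :
    ∃ a : E → Option (β ⊕ γ), (∀ k, mmInt (∑ e with a e = some k, z e)) ∧
      ∀ w : E → ℝ, (∀ k, ∑ e with a e = some k, w e = 0) →
        (∀ k ∈ Kb, ∑ e with b e = k, z e = 1 → ∑ e with b e = k, w e = 0) ∧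
        (∀ t ∈ Kg, ∑ e with g (b e) = t, z e = 1 → ∑ e with g (b e) = t, w e = 0) := by
  set TB : Finset β := Kb.filter (fun k => ∑ e with b e = k, z e = 1) with hTB
  set TG : Finset γ := Kg.filter (fun t => ∑ e with g (b e) = t, z e = 1) with hTG
  let a : E → Option (β ⊕ γ) := fun e =>
    if b e ∈ TB then some (Sum.inl (b e))
    else if g (b e) ∈ TG then some (Sum.inr (g (b e))) else none
  have hal : ∀ k, (univ.filter (fun e => a e = some (Sum.inl k))) =
      if k ∈ TB then univ.filter (fun e => b e = k) else ∅ := by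
    intro k
    ext e
    by_cases h1 : b e ∈ TB <;> by_cases h2 : g (b e) ∈ TG <;> by_cases h3 : k ∈ TB <;>
      simp [a, h1, h2, h3] <;> grind
  have har : ∀ t, (univ.filter (fun e => a e = some (Sum.inr t))) =
      if t ∈ TG then univ.filter (fun e => g (b e) = t ∧ b e ∉ TB) else ∅ := by
    intro k
    ext e
    by_cases h1 : b e ∈ TB <;> by_cases h2 : g (b e) ∈ TG <;> by_cases h3 : k ∈ TG <;>
      simp [a, h1, h2, h3] <;> grind
  have hsplit : ∀ (w : E → ℝ) t, ∑ e with g (b e) = t, w e =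
      ∑ e with (g (b e) = t ∧ b e ∉ TB), w e +
        ∑ k ∈ TB.filter (fun k => g k = t), ∑ e with b e = k, w e := by
    intro w t
    rw [← Finset.sum_filter_add_sum_filter_not (univ.filter (fun e => g (b e) = t))
      (fun e => b e ∉ TB)]
    congr 1
    · rw [Finset.filter_filter]
    · rw [← Finset.sum_fiberwise_of_maps_to (t := TB.filter (fun k => g k = t)) (g := b)]
      · apply Finset.sum_congr rfl
        intro k hk
        apply Finset.sum_congr _ (fun _ _ => rfl)
        ext e
        simp only [mem_filter, mem_univ, true_and] at hk ⊢
        grind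
      · intro e he
        simp only [mem_filter, mem_univ, true_and] at he ⊢
        grind
  refine ⟨a, ?_, ?_⟩
  · rintro (k | t)
    · rw [hal]
      split_ifs with h
      · rw [(mem_filter.1 h).2]; exact ⟨1, by simp⟩
      · exact ⟨0, by simp⟩
    · rw [har]
      split_ifs with h
      · have h1 := hsplit z t
        rw [(mem_filter.1 h).2] at h1
        have h2 : mmInt (∑ k ∈ TB.filter (fun k => g k = t), ∑ e with b e = k, z e) := by
          apply mmInt.sum
          intro k hk
          rw [(mem_filter.1 (mem_filter.1 hk).1).2]
          exact ⟨1, by simp⟩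
        have h3 : mmInt 1 := ⟨1, by simp⟩
        have h4 := h3.sub h2
        rw [h1, add_sub_cancel_right] at h4
        exact h4
      · exact ⟨0, by simp⟩
  · intro w hw
    have hB : ∀ k ∈ TB, ∑ e with b e = k, w e = 0 := by
      intro k hk
      have := hw (Sum.inl k)
      rw [hal, if_pos hk] at this
      exact this
    refine ⟨fun k hk hk1 => hB k (mem_filter.2 ⟨hk, hk1⟩), fun t ht ht1 => ?_⟩
    have hT : t ∈ TG := mem_filter.2 ⟨ht, ht1⟩
    have := hw (Sum.inr t)
    rw [har, if_pos hT] at this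
    rw [hsplit, this, zero_add]
    apply Finset.sum_eq_zero
    intro k hk
    exact hB k (mem_filter.1 hk).1

/-- The polytope: a (poly)matroid together with a two-level laminar system of constraints. -/
def mmP {E β γ : Type*} [Fintype E] (r : Finset E → ℕ) (b : E → β) (g : β → γ) (Kb : Finset β)
    (Kg : Finset γ) : Set (E → ℝ) :=
  {z | (∀ e, 0 ≤ z e) ∧ (∀ S : Finset E, ∑ e ∈ S, z e ≤ (r S : ℝ)) ∧
    (∀ k ∈ Kb, ∑ e with b e = k, z e ≤ 1) ∧ (∀ t ∈ Kg, 1 ≤ ∑ e with g (b e) = t, z e)}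

lemma mmP_compact {E β γ : Type*} [Fintype E] (r : Finset E → ℕ) (b : E → β) (g : β → γ)
    (Kb : Finset β) (Kg : Finset γ) : IsCompact (mmP r b g Kb Kg) := by
  apply IsCompact.of_isClosed_subset (isCompact_Icc (a := (0 : E → ℝ)) (b := fun e => (r {e} : ℝ)))
  · have : mmP r b g Kb Kg = (⋂ e, {z : E → ℝ | 0 ≤ z e}) ∩
        ((⋂ S : Finset E, {z : E → ℝ | ∑ e ∈ S, z e ≤ (r S : ℝ)}) ∩
        ((⋂ k, ⋂ (_ : k ∈ Kb), {z : E → ℝ | ∑ e with b e = k, z e ≤ 1}) ∩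
        (⋂ t, ⋂ (_ : t ∈ Kg), {z : E → ℝ | 1 ≤ ∑ e with g (b e) = t, z e}))) := by
      ext z
      simp [mmP]
    rw [this]
    refine IsClosed.inter (isClosed_iInter fun e => ?_) (IsClosed.inter
      (isClosed_iInter fun e => ?_) (IsClosed.inter
      (isClosed_iInter fun e => isClosed_iInter fun _ => ?_)
      (isClosed_iInter fun e => isClosed_iInter fun _ => ?_)))
    · exact isClosed_le (by fun_prop) (by fun_prop)
    · exact isClosed_le (by fun_prop) (by fun_prop)
    · exact isClosed_le (by fun_prop) (by fun_prop)
    · exact isClosed_le (by fun_prop) (by fun_prop)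
  · intro z hz
    refine ⟨fun e => hz.1 e, fun e => ?_⟩
    have := hz.2.1 {e}
    simpa using this

lemma mm_small (p q c : ℝ) (h : p ≤ c) (ht : p = c → q = 0) :
    ∀ᶠ ε : ℝ in nhds 0, p + ε * q ≤ c := by
  rcases h.eq_or_lt with h | h
  · rw [ht h]
    simp [h]
  · have hc : Filter.Tendsto (fun ε : ℝ => p + ε * q) (nhds 0) (nhds (p + 0 * q)) :=
      Continuous.tendsto (by fun_prop) 0
    rw [zero_mul, add_zero] at hc
    exact (hc.eventually (gt_mem_nhds h)).mono fun _ h => le_of_lt h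

lemma mm_integral {E β γ : Type*} [Fintype E] (r : Finset E → ℕ) (hr0 : r ∅ = 0)
    (hsub : ∀ S T, r (S ∩ T) + r (S ∪ T) ≤ r S + r T) (b : E → β) (g : β → γ)
    (Kb : Finset β) (Kg : Finset γ) (y : E → ℝ) (hy : y ∈ mmP r b g Kb Kg) (l : E → ℝ) :
    ∃ z ∈ mmP r b g Kb Kg, (∀ e, mmInt (z e)) ∧ ∑ e, l e * z e ≤ ∑ e, l e * y e := by
  let L : (E → ℝ) →L[ℝ] ℝ := ∑ e, l e • ContinuousLinearMap.proj e
  have hL : ∀ w, L w = ∑ e, l e * w e := by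
    intro w
    simp [L]
  obtain ⟨z, hz, hmin⟩ := mm_exists_extreme_min _ (mmP_compact r b g Kb Kg) ⟨y, hy⟩ L
  have hzP := hz.1
  refine ⟨z, hzP, ?_, by simpa only [hL] using hmin y hy⟩
  by_contra hni
  push Not at hni
  obtain ⟨a1, ha1, hk1⟩ := mm_left r hr0 hsub z hzP.2.1
  obtain ⟨a2, ha2, hk2⟩ := mm_right b g Kb Kg z
  obtain ⟨w, hw0, hwi, hw1, hw2⟩ := mm_perturb z a1 a2
    (fun k => by convert ha1 k) (fun k => by convert ha2 k) hni
  have hR1 := hk1 w (fun k => by convert hw1 k)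
  obtain ⟨hR2, hR3⟩ := hk2 w (fun k => by convert hw2 k)
  have hev : ∀ᶠ ε : ℝ in nhds 0, z + ε • w ∈ mmP r b g Kb Kg := by
    have e1 : ∀ᶠ ε : ℝ in nhds 0, ∀ e, 0 ≤ z e + ε * w e := by
      rw [Filter.eventually_all]
      intro e
      have := mm_small (-z e) (-w e) 0 (by linarith [hzP.1 e])
        (fun h => by rw [hwi e ⟨0, by push_cast; linarith⟩, neg_zero])
      exact this.mono fun ε h => by linarith
    have e2 : ∀ᶠ ε : ℝ in nhds 0, ∀ S : Finset E, ∑ e ∈ S, z e + ε * ∑ e ∈ S, w e ≤ (r S : ℝ) := by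
      rw [Filter.eventually_all]
      intro S
      exact mm_small _ _ _ (hzP.2.1 S) (hR1 S)
    have e3 : ∀ᶠ ε : ℝ in nhds 0, ∀ k ∈ Kb,
        ∑ e with b e = k, z e + ε * ∑ e with b e = k, w e ≤ 1 := by
      rw [Filter.eventually_all_finset]
      intro k hk
      exact mm_small _ _ _ (hzP.2.2.1 k hk) (hR2 k hk)
    have e4 : ∀ᶠ ε : ℝ in nhds 0, ∀ t ∈ Kg,
        1 ≤ ∑ e with g (b e) = t, z e + ε * ∑ e with g (b e) = t, w e := by
      rw [Filter.eventually_all_finset]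
      intro t ht
      have := mm_small (-∑ e with g (b e) = t, z e) (-∑ e with g (b e) = t, w e) (-1)
        (by linarith [hzP.2.2.2 t ht])
        (fun h => by rw [hR3 t ht (by linarith), neg_zero])
      exact this.mono fun ε h => by linarith
    filter_upwards [e1, e2, e3, e4] with ε h1 h2 h3 h4
    simp only [mmP, Set.mem_ofPred_eq, Pi.add_apply, Pi.smul_apply, smul_eq_mul,
      Finset.sum_add_distrib, ← Finset.mul_sum]
    exact ⟨h1, h2, h3, h4⟩
  have hneg : ∀ᶠ ε : ℝ in nhds 0, z + (-ε) • w ∈ mmP r b g Kb Kg := by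
    have : Filter.Tendsto (fun ε : ℝ => -ε) (nhds 0) (nhds 0) := by
      simpa using (continuous_neg (G := ℝ)).tendsto 0
    exact this.eventually hev
  obtain ⟨δ, hδ, hball⟩ := Metric.eventually_nhds_iff.1 (hev.and hneg)
  obtain ⟨hp, hm⟩ := hball (y := δ / 2) (by rw [Real.dist_eq, sub_zero, abs_of_pos] <;> linarith)
  have hseg : z ∈ openSegment ℝ (z + (δ / 2) • w) (z + (-(δ / 2)) • w) := by
    refine ⟨1 / 2, 1 / 2, by norm_num, by norm_num, by norm_num, ?_⟩
    ext e
    simp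
    ring
  have heq := hz.2 hp hm hseg
  apply hw0
  have h5 : (δ / 2) • w = 0 := by simpa using heq
  exact (smul_eq_zero.1 h5).resolve_left (by linarith)

lemma mm_label {α β : Type*} (P : α → β → Prop) (huniq : ∀ a b b', P a b → P a b' → b = b') :
    ∃ φ : α → Option β, ∀ a b, φ a = some b ↔ P a b := by
  refine ⟨fun a => if h : ∃ b, P a b then some h.choose else none, fun a b => ?_⟩
  beta_reduce
  by_cases h : ∃ b, P a b
  · rw [dif_pos h]
    constructor
    · intro hb
      rw [← Option.some.inj hb]
      exact h.choose_spec
    · intro hb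
      rw [huniq a _ _ h.choose_spec hb]
  · rw [dif_neg h]
    constructor
    · intro hb
      cases hb
    · intro hb
      exact absurd ⟨b, hb⟩ h

lemma mm_core {F D : Type*} [Fintype F] [Fintype D]
    (ci : F → D → ℝ) (cc : D → D → ℝ)
    (hci : ∀ i j, 0 ≤ ci i j) (hcc : ∀ j k, 0 ≤ cc j k) (hsymm : ∀ j k, cc j k = cc k j)
    (htri1 : ∀ i j k, ci i k ≤ ci i j + cc j k)
    (htri2 : ∀ i j k, cc j k ≤ ci i j + ci i k)
    (f : F → ℝ) (hf : ∀ i, 0 ≤ f i)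
    (d : D → ℝ) (hd : ∀ j, 0 ≤ d j)
    (M : Matroid F)
    (x : F → D → ℝ) (y : F → ℝ)
    (hx : ∀ i j, 0 ≤ x i j)
    (hy : ∀ i, 0 ≤ y i)
    (hx1 : ∀ j, ∑ i, x i j = 1)
    (hxy : ∀ i j, x i j ≤ y i)
    (hrank : ∀ S : Finset F, ∑ i ∈ S, y i ≤ (matroidRank M S : ℝ)) :
    ∃ (Fs : Finset F) (σ : D → F),
      M.Indep ↑Fs ∧ (∀ j, σ j ∈ Fs) ∧
      (∑ i ∈ Fs, f i) + ∑ j, d j * ci (σ j) j ≤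
        (∑ i, f i * y i) + 9 * ∑ j, d j * ∑ i, ci i j * x i j := by
  set Cb : D → ℝ := fun j => ∑ i, ci i j * x i j with hCb
  have hCb0 : ∀ j, 0 ≤ Cb j := fun j => Finset.sum_nonneg fun i _ => mul_nonneg (hci i j) (hx i j)
  -- consolidation of clients
  have hself : ∀ j, cc j j ≤ 4 * max (Cb j) (Cb j) := by
    intro j
    have h1 : cc j j = ∑ i, cc j j * x i j := by rw [← Finset.mul_sum, hx1, mul_one]
    have h2 : ∑ i, cc j j * x i j ≤ ∑ i, 2 * (ci i j * x i j) := by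
      apply Finset.sum_le_sum
      intro i _
      nlinarith [htri2 i j j, hx i j]
    rw [← h1, ← Finset.mul_sum] at h2
    have h3 := hCb0 j
    rw [max_self]
    change _ ≤ 2 * Cb j at h2
    linarith
  obtain ⟨C, -, hC1, hC2⟩ := mm_greedy Cb (fun j k => cc j k ≤ 4 * max (Cb j) (Cb k)) hself univ
  have hCsep : ∀ j ∈ C, ∀ k ∈ C, k ≠ j → 4 * Cb j < cc j k := by
    intro j hj k hk hne
    by_contra hle
    push Not at hle
    have h1 : cc j k ≤ 4 * max (Cb j) (Cb k) := by linarith [le_max_left (Cb j) (Cb k)]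
    exact hne (hC1 j hj k hk h1 (by rw [hsymm, max_comm]; exact h1)).symm
  have hC3 : ∀ j, ∃ k ∈ C, Cb k ≤ Cb j ∧ cc k j ≤ 4 * Cb j := by
    intro j
    obtain ⟨k, hk, h1, h2⟩ := hC2 j (mem_univ _)
    rw [max_eq_right h1] at h2
    exact ⟨k, hk, h1, h2⟩
  choose m hmC hmCb hmcc using hC3
  -- nearest neighbours
  have hnear : ∀ j, ∃ (n : D) (R : ℝ), j ∈ C → n ∈ C ∧ 2 * Cb j < R ∧ cc j n ≤ 2 * R ∧
      (∀ k ∈ C, k ≠ j → 2 * R ≤ cc j k) ∧ (n = j → ∀ i, ci i j < R) := by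
    intro j
    by_cases hne : (C.erase j).Nonempty
    · obtain ⟨n, hn, hmin⟩ := Finset.exists_min_image (C.erase j) (cc j) hne
      rw [mem_erase] at hn
      refine ⟨n, cc j n / 2, fun hj => ⟨hn.2, ?_, by linarith, ?_, fun h => absurd h hn.1⟩⟩
      · linarith [hCsep j hj n hn.2 hn.1]
      · intro k hk hkj
        linarith [hmin k (mem_erase.2 ⟨hkj, hk⟩)]
    · have hS : 0 ≤ ∑ i, ci i j := Finset.sum_nonneg fun i _ => hci i j
      have h0 := hCb0 j
      have h1 := hcc j j
      refine ⟨j, 1 + 2 * Cb j + cc j j + ∑ i, ci i j, fun hj =>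
        ⟨hj, by linarith, by linarith, ?_, ?_⟩⟩
      · intro k hk hkj
        exact absurd ⟨k, mem_erase.2 ⟨hkj, hk⟩⟩ hne
      · intro _ i
        have := Finset.single_le_sum (f := fun i => ci i j) (fun i _ => hci i j) (mem_univ i)
        linarith
  choose n R hnR using hnear
  have hnC : ∀ j ∈ C, n j ∈ C := fun j hj => (hnR j hj).1
  have hRC : ∀ j ∈ C, 2 * Cb j < R j := fun j hj => (hnR j hj).2.1
  have hnd : ∀ j ∈ C, cc j (n j) ≤ 2 * R j := fun j hj => (hnR j hj).2.2.1
  have hRmin : ∀ j ∈ C, ∀ k ∈ C, k ≠ j → 2 * R j ≤ cc j k := fun j hj => (hnR j hj).2.2.2.1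
  have hnself : ∀ j ∈ C, n j = j → ∀ i, ci i j < R j := fun j hj => (hnR j hj).2.2.2.2
  have hRpos : ∀ j ∈ C, 0 < R j := fun j hj => by linarith [hRC j hj, hCb0 j]
  have hRn : ∀ j ∈ C, R (n j) ≤ R j := by
    intro j hj
    by_cases h : n j = j
    · rw [h]
    · have h1 := hRmin (n j) (hnC j hj) j hj (Ne.symm h)
      have h2 := hnd j hj
      rw [hsymm] at h1
      linarith
  -- groups
  obtain ⟨T, hTC, hT1, hT2⟩ := mm_greedy R
    (fun t j => t = j ∨ t = n j ∨ n t = j ∨ n t = n j) (fun _ => Or.inl rfl) C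
  obtain ⟨b, hb⟩ := mm_label (fun (i : F) (k : D) => k ∈ C ∧ ci i k < R k) (by
    rintro i k l ⟨hk, hik⟩ ⟨hl, hil⟩
    by_contra hne
    have h1 := hRmin k hk l hl (Ne.symm hne)
    have h2 := hRmin l hl k hk hne
    rw [hsymm] at h2
    have h3 := htri2 i k l
    linarith)
  obtain ⟨g0, hg0⟩ := mm_label (fun (k t : D) => t ∈ T ∧ (k = t ∨ k = n t)) (by
    rintro k s t ⟨hs, hks⟩ ⟨ht, hkt⟩
    apply hT1 s hs t ht
    · rcases hks with h | h <;> rcases hkt with h' | h' <;> simp [← h, ← h']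
    · rcases hks with h | h <;> rcases hkt with h' | h' <;> simp [← h, ← h'])
  let g : Option D → Option D := fun o => o.bind g0
  have hg : ∀ o t, g o = some t ↔ ∃ k, o = some k ∧ t ∈ T ∧ (k = t ∨ k = n t) := by
    intro o t
    cases o with
    | none => simp [g]
    | some k => simp [g, hg0]
  let y' : F → ℝ := fun i => (b i).elim 0 (x i)
  have hy'some : ∀ i k, b i = some k → y' i = x i k := by
    intro i k h
    simp [y', h]
  have hy'0 : ∀ i, 0 ≤ y' i := by
    intro i
    cases h : b i with
    | none => simp [y', h]
    | some k => rw [hy'some i k h]; exact hx i k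
  have hy'y : ∀ i, y' i ≤ y i := by
    intro i
    cases h : b i with
    | none => simpa [y', h] using hy i
    | some k => rw [hy'some i k h]; exact hxy i k
  have hs : ∀ k, ∑ i with b i = some k, y' i = ∑ i with b i = some k, x i k := by
    intro k
    apply Finset.sum_congr rfl
    intro i hi
    exact hy'some i k (mem_filter.1 hi).2
  have hsplit : ∀ k, ∑ i with b i = some k, x i k + ∑ i with ¬ b i = some k, x i k = 1 := by
    intro k
    rw [Finset.sum_filter_add_sum_filter_not, hx1]
  have hsle : ∀ k, ∑ i with b i = some k, y' i ≤ 1 := by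
    intro k
    rw [hs, ← hsplit k]
    have : 0 ≤ ∑ i with ¬ b i = some k, x i k := Finset.sum_nonneg fun i _ => hx i k
    linarith
  have hmarkov : ∀ k ∈ C, ∑ i with b i = some k, ci i k * y' i +
      R k * (1 - ∑ i with b i = some k, y' i) ≤ Cb k := by
    intro k hk
    have h1 : ∑ i with b i = some k, ci i k * y' i = ∑ i with b i = some k, ci i k * x i k := by
      apply Finset.sum_congr rfl
      intro i hi
      rw [hy'some i k (mem_filter.1 hi).2]
    have h2 : Cb k = ∑ i with b i = some k, ci i k * x i k +
        ∑ i with ¬ b i = some k, ci i k * x i k := by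
      rw [Finset.sum_filter_add_sum_filter_not]
    have h3 : R k * ∑ i with ¬ b i = some k, x i k ≤
        ∑ i with ¬ b i = some k, ci i k * x i k := by
      rw [Finset.mul_sum]
      apply Finset.sum_le_sum
      intro i hi
      apply mul_le_mul_of_nonneg_right _ (hx i k)
      by_contra hlt
      push Not at hlt
      exact (mem_filter.1 hi).2 ((hb i k).2 ⟨hk, hlt⟩)
    have h4 : 1 - ∑ i with b i = some k, y' i = ∑ i with ¬ b i = some k, x i k := by
      rw [hs, ← hsplit k]; ring
    rw [h1, h2, h4]
    linarith
  have hshalf : ∀ k ∈ C, 1 / 2 ≤ ∑ i with b i = some k, y' i := by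
    intro k hk
    have h1 := hmarkov k hk
    have h2 : 0 ≤ ∑ i with b i = some k, ci i k * y' i :=
      Finset.sum_nonneg fun i _ => mul_nonneg (hci i k) (hy'0 i)
    have h3 := hRC k hk
    have h4 := hRpos k hk
    by_contra hlt
    push Not at hlt
    nlinarith
  have hy'P : y' ∈ mmP (matroidRank M) b g (C.image some) (T.image some) := by
    refine ⟨hy'0, ?_, ?_, ?_⟩
    · intro S
      exact (Finset.sum_le_sum fun i _ => hy'y i).trans (hrank S)
    · intro o ho
      obtain ⟨k, -, rfl⟩ := mem_image.1 ho
      convert hsle k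
    · intro o ho
      obtain ⟨t, ht, rfl⟩ := mem_image.1 ho
      have htC := hTC ht
      suffices key : 1 ≤ ∑ i with g (b i) = some t, y' i by convert key
      by_cases hnt : n t = t
      · have h1 : ∀ i, b i = some t := fun i => (hb i t).2 ⟨htC, hnself t htC hnt i⟩
        have h2 : ∀ i, g (b i) = some t := fun i => (hg _ _).2 ⟨t, h1 i, ht, Or.inl rfl⟩
        rw [Finset.filter_true_of_mem (fun i _ => h2 i), ← hx1 t]
        exact (Finset.sum_congr rfl fun i _ => (hy'some i t (h1 i)).symm).le
      · have hdisj : Disjoint (univ.filter (fun i => b i = some t))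
            (univ.filter (fun i => b i = some (n t))) := by
          rw [Finset.disjoint_left]
          intro i hi hi'
          have h1 := (mem_filter.1 hi).2
          have h2 := (mem_filter.1 hi').2
          rw [h1] at h2
          exact hnt (Option.some.inj h2).symm
        have hle : ∑ i ∈ (univ.filter (fun i => b i = some t)) ∪
            (univ.filter (fun i => b i = some (n t))), y' i ≤ ∑ i with g (b i) = some t, y' i := by
          apply Finset.sum_le_sum_of_subset_of_nonneg
          · intro i hi
            rw [mem_filter]
            refine ⟨mem_univ _, (hg _ _).2 ?_⟩
            rcases mem_union.1 hi with h | h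
            · exact ⟨t, (mem_filter.1 h).2, ht, Or.inl rfl⟩
            · exact ⟨n t, (mem_filter.1 h).2, ht, Or.inr rfl⟩
          · intro i _ _
            exact hy'0 i
        rw [Finset.sum_union hdisj] at hle
        linarith [hshalf t htC, hshalf (n t) (hnC t htC)]
  -- the linear objective
  let Conn : D → (F → ℝ) → ℝ := fun k z =>
    5 * R k + ∑ i with b i = some k, (ci i k - 5 * R k) * z i
  let l : F → ℝ := fun i =>
    f i + ∑ j, d j * (if b i = some (m j) then ci i (m j) - 5 * R (m j) else 0)
  have hl : ∀ z : F → ℝ, ∑ i, l i * z i + ∑ j, d j * (5 * R (m j)) =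
      ∑ i, f i * z i + ∑ j, d j * Conn (m j) z := by
    intro z
    have h1 : ∑ i, l i * z i = ∑ i, f i * z i + ∑ j, d j *
        ∑ i with b i = some (m j), (ci i (m j) - 5 * R (m j)) * z i := by
      simp only [l, add_mul, Finset.sum_add_distrib, Finset.sum_mul]
      congr 1
      rw [Finset.sum_comm]
      apply Finset.sum_congr rfl
      intro j _
      rw [Finset.mul_sum, Finset.sum_filter]
      apply Finset.sum_congr rfl
      intro i _
      split_ifs <;> ring
    rw [h1, add_assoc, ← Finset.sum_add_distrib]
    congr 1
    apply Finset.sum_congr rfl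
    intro j _
    simp only [Conn]
    ring
  have hConny : ∀ k ∈ C, Conn k y' ≤ 5 * Cb k := by
    intro k hk
    have h1 := hmarkov k hk
    have h2 : 0 ≤ ∑ i with b i = some k, ci i k * y' i :=
      Finset.sum_nonneg fun i _ => mul_nonneg (hci i k) (hy'0 i)
    have h3 : Conn k y' = ∑ i with b i = some k, ci i k * y' i +
        5 * (R k * (1 - ∑ i with b i = some k, y' i)) := by
      simp only [Conn, sub_mul, Finset.sum_sub_distrib, ← Finset.mul_sum]
      ring
    rw [h3]
    linarith
  obtain ⟨z, hzP, hzint, hzl⟩ := mm_integral (matroidRank M) (mm_rank_empty M) (mm_rank_submod M)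
    b g (C.image some) (T.image some) y' (by convert hy'P) l
  obtain ⟨hz0, hzr, hzb, hzg⟩ := hzP
  have hz01 : ∀ i, z i = 0 ∨ z i = 1 := by
    intro i
    have h1 := hz0 i
    have h2 := hzr {i}
    have h3 : (matroidRank M {i} : ℝ) ≤ 1 := by
      exact_mod_cast (mm_rank_le_card M {i})
    rw [Finset.sum_singleton] at h2
    obtain ⟨q, hq⟩ := hzint i
    rw [hq] at h1 h2 ⊢
    have h4 : (0 : ℤ) ≤ q := by exact_mod_cast h1
    have h5 : q ≤ (1 : ℤ) := by exact_mod_cast h2.trans h3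
    have h6 : q = 0 ∨ q = 1 := by omega
    rcases h6 with rfl | rfl <;> simp
  set Fs : Finset F := univ.filter (fun i => z i = 1) with hFs
  have hFmem : ∀ i, i ∈ Fs ↔ z i = 1 := by simp [hFs]
  have hFindep : M.Indep (Fs : Set F) := by
    apply mm_indep_of_card_le
    have h1 := hzr Fs
    rw [Finset.sum_congr rfl (fun i hi => (hFmem i).1 hi), Finset.sum_const, nsmul_eq_mul,
      mul_one] at h1
    exact_mod_cast h1
  have hFf : ∑ i ∈ Fs, f i = ∑ i, f i * z i := by
    rw [hFs, Finset.sum_filter]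
    apply Finset.sum_congr rfl
    intro i _
    rcases hz01 i with h | h <;> simp [h]
  have hserve : ∀ k ∈ C, ∃ i ∈ Fs, ci i k ≤ Conn k z := by
    intro k hk
    by_cases hex : ∃ i, b i = some k ∧ z i = 1
    · obtain ⟨i, hbi, hzi⟩ := hex
      refine ⟨i, (hFmem i).2 hzi, ?_⟩
      have hmem : i ∈ univ.filter (fun i => b i = some k) := by simp [hbi]
      have h1 : ∑ i with b i = some k, z i ≤ 1 := by
        convert hzb (some k) (mem_image_of_mem _ hk)
      rw [← Finset.add_sum_erase _ _ hmem, hzi] at h1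
      have h2 : ∀ i' ∈ (univ.filter (fun i => b i = some k)).erase i, z i' = 0 := by
        have h3 : ∑ i' ∈ (univ.filter (fun i => b i = some k)).erase i, z i' = 0 :=
          le_antisymm (by linarith) (Finset.sum_nonneg fun i' _ => hz0 i')
        exact (Finset.sum_eq_zero_iff_of_nonneg fun i' _ => hz0 i').1 h3
      have h4 : Conn k z = ci i k := by
        simp only [Conn]
        rw [← Finset.add_sum_erase _ _ hmem, hzi,
          Finset.sum_eq_zero (fun i' hi' => by rw [h2 i' hi', mul_zero])]
        ring
      rw [h4]
    · have h1 : Conn k z = 5 * R k := by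
        simp only [Conn]
        rw [Finset.sum_eq_zero, add_zero]
        intro i hi
        rcases hz01 i with h | h
        · rw [h, mul_zero]
        · exact absurd ⟨i, (mem_filter.1 hi).2, h⟩ hex
      rw [h1]
      obtain ⟨t, ht, hRt, hconf⟩ := hT2 k hk
      have htC := hTC ht
      have h2 : 1 ≤ ∑ i with g (b i) = some t, z i := by
        convert hzg (some t) (mem_image_of_mem _ ht)
      obtain ⟨i, hi, hzi⟩ : ∃ i ∈ univ.filter (fun i => g (b i) = some t), z i ≠ 0 := by
        by_contra hno
        push Not at hno
        rw [Finset.sum_eq_zero hno] at h2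
        linarith
      refine ⟨i, (hFmem i).2 ((hz01 i).resolve_left hzi), ?_⟩
      obtain ⟨a, hba, -, hat⟩ := (hg _ _).1 (mem_filter.1 hi).2
      obtain ⟨haC, hia⟩ := (hb i a).1 hba
      have hRk := hRpos k hk
      have hRa : R a ≤ R k := by
        rcases hat with rfl | rfl
        · exact hRt
        · exact (hRn t htC).trans hRt
      have hdt := hnd t htC
      have hdk := hnd k hk
      -- distance from `i` to any member of the group of `t`
      have hgrp : ∀ q, q = t ∨ q = n t → ci i q ≤ 3 * R k := by
        intro q hq
        by_cases hqa : q = a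
        · rw [hqa]; linarith
        · have h3 : cc a q ≤ 2 * R t := by
            rcases hat with rfl | rfl <;> rcases hq with rfl | rfl
            · exact absurd rfl hqa
            · exact hdt
            · rw [hsymm]; exact hdt
            · exact absurd rfl hqa
          linarith [htri1 i a q]
      have hdk' := hdk
      rw [hsymm] at hdk'
      have h6 := htri1 i (n k) k
      rcases hconf with h | h | h | h
      · linarith [hgrp k (Or.inl h.symm)]
      · linarith [hgrp (n k) (Or.inl h.symm)]
      · linarith [hgrp k (Or.inr h.symm)]
      · linarith [hgrp (n k) (Or.inr h.symm)]
  have hserve' : ∀ j, ∃ i ∈ Fs, ci i (m j) ≤ Conn (m j) z := fun j => hserve (m j) (hmC j)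
  choose σ hσF hσ using hserve'
  refine ⟨Fs, σ, hFindep, hσF, ?_⟩
  have k1 : ∑ j, d j * ci (σ j) j ≤ ∑ j, d j * Conn (m j) z + 4 * ∑ j, d j * Cb j := by
    rw [Finset.mul_sum, ← Finset.sum_add_distrib]
    apply Finset.sum_le_sum
    intro j _
    have h1 := htri1 (σ j) (m j) j
    have h2 := hσ j
    have h3 := hmcc j
    have h4 : ci (σ j) j ≤ Conn (m j) z + 4 * Cb j := by linarith
    have h5 := mul_le_mul_of_nonneg_left h4 (hd j)
    linarith
  have k2 : ∑ j, d j * Conn (m j) y' ≤ 5 * ∑ j, d j * Cb j := by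
    rw [Finset.mul_sum]
    apply Finset.sum_le_sum
    intro j _
    have h1 := hConny (m j) (hmC j)
    have h2 := hmCb j
    have h4 : Conn (m j) y' ≤ 5 * Cb j := by linarith
    have h5 := mul_le_mul_of_nonneg_left h4 (hd j)
    linarith
  have k3 : ∑ i, f i * y' i ≤ ∑ i, f i * y i :=
    Finset.sum_le_sum fun i _ => mul_le_mul_of_nonneg_left (hy'y i) (hf i)
  have k4 := hl z
  have k5 := hl y'
  rw [hFf]
  linarith

/-- Theorem 3.5: any fractional matroid-median solution can be rounded to an
integral solution of cost at most 10 times larger. -/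
theorem matroid_median_integrality_gap_10
    {F D : Type*} [Fintype F] [Fintype D]
    (c : F ⊕ D → F ⊕ D → ℝ)
    (hc_nonneg : ∀ u v, 0 ≤ c u v)
    (hc_symm : ∀ u v, c u v = c v u)
    (hc_tri : ∀ u v w, c u w ≤ c u v + c v w)
    (f : F → ℝ) (hf : ∀ i, 0 ≤ f i)
    (d : D → ℝ) (hd : ∀ j, 0 ≤ d j)
    (M : Matroid F) (hME : M.E = Set.univ)
    (x : F → D → ℝ) (y : F → ℝ)
    (hx : ∀ i j, 0 ≤ x i j) (hy : ∀ i, 0 ≤ y i)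
    (hx1 : ∀ j, 1 ≤ ∑ i, x i j)
    (hxy : ∀ i j, x i j ≤ y i)
    (hrank : ∀ S : Finset F, ∑ i ∈ S, y i ≤ (matroidRank M S : ℝ)) :
    ∃ (Fs : Finset F) (σ : D → F),
      M.Indep ↑Fs ∧ (∀ j, σ j ∈ Fs) ∧
      (∑ i ∈ Fs, f i) + ∑ j, d j * c (Sum.inl (σ j)) (Sum.inr j) ≤
        10 * ((∑ i, f i * y i) + ∑ j, ∑ i, d j * c (Sum.inl i) (Sum.inr j) * x i j) := by
  have hpos : ∀ j, 0 < ∑ i, x i j := fun j => lt_of_lt_of_le one_pos (hx1 j)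
  have hle : ∀ i j, x i j / ∑ i, x i j ≤ x i j := fun i j => div_le_self (hx i j) (hx1 j)
  obtain ⟨Fs, σ, h1, h2, h3⟩ := mm_core (fun i j => c (Sum.inl i) (Sum.inr j))
    (fun j k => c (Sum.inr j) (Sum.inr k)) (fun _ _ => hc_nonneg _ _) (fun _ _ => hc_nonneg _ _)
    (fun _ _ => hc_symm _ _) (fun _ _ _ => hc_tri _ _ _)
    (fun i j k => by
      rw [hc_symm (Sum.inl i) (Sum.inr j)]
      exact hc_tri _ _ _)
    f hf d hd M (fun i j => x i j / ∑ i, x i j) y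
    (fun i j => div_nonneg (hx i j) (hpos j).le) hy
    (fun j => by rw [← Finset.sum_div]; exact div_self (hpos j).ne')
    (fun i j => (hle i j).trans (hxy i j)) hrank
  refine ⟨Fs, σ, h1, h2, h3.trans ?_⟩
  have k1 : ∑ j, d j * ∑ i, c (Sum.inl i) (Sum.inr j) * (x i j / ∑ i, x i j) ≤
      ∑ j, ∑ i, d j * c (Sum.inl i) (Sum.inr j) * x i j := by
    apply Finset.sum_le_sum
    intro j _
    rw [Finset.mul_sum]
    apply Finset.sum_le_sum
    intro i _
    rw [← mul_assoc]
    exact mul_le_mul_of_nonneg_left (hle i j) (mul_nonneg (hd j) (hc_nonneg _ _))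
  have k2 : 0 ≤ ∑ j, ∑ i, d j * c (Sum.inl i) (Sum.inr j) * x i j :=
    Finset.sum_nonneg fun j _ => Finset.sum_nonneg fun i _ =>
      mul_nonneg (mul_nonneg (hd j) (hc_nonneg _ _)) (hx i j)
  have k3 : 0 ≤ ∑ i, f i * y i := Finset.sum_nonneg fun i _ => mul_nonneg (hf i) (hy i)
  linarith
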